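/- For all s,m,n ≥ 0: (1) for all i with 1 ≤ i ≤ m+1 and all j with 1 ≤ j ≤ n+1, Int ⊢ E_{s,m,n} ↔ Ê_{s,i,j}[P_{m−i,n−j}, Q_{m−i,n−j}]; (2) if m = 0 and n ≥ 1, then Int ⊢ E_{s,0,n} ↔ (A_{n+1}^2 ∧ B_{n+1}^2 → Ê_{s,0,*}[p, A_n^2 ∨ B_n^2]); (3) if m ≥ 1 and n = 0, then Int ⊢ E_{s,m,0} ↔ (A_{m+1}^1 ∧ B_{m+1}^1 → Ê_{s,*,0}[A_m^1 ∨ B_m^1, q]); (4) Int ⊢ E_{s,0,0} ↔ Ê_{s,0,0}. Here Ê[X,Y] denotes the result of substituting X for p and Y for q. -/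

import Mathlib

namespace Paper

/-- Propositional formulas over variables indexed by ℕ, with ⊥, ∧, ∨, →. -/
inductive Fml : Type
  | var : ℕ → Fml
  | bot : Fml
  | and : Fml → Fml → Fml
  | or : Fml → Fml → Fml
  | imp : Fml → Fml → Fml

namespace Fml

/-- ¬A := A → ⊥ -/
def neg (A : Fml) : Fml := A.imp bot

/-- A ↔ B := (A → B) ∧ (B → A) -/
def biimp (A B : Fml) : Fml := (A.imp B).and (B.imp A)

/-- The three fixed distinct variables p, q, r. -/
def p : Fml := var 0
def q : Fml := var 1
def r : Fml := var 2

/-- Applying a substitution σ to a formula. -/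
def subst (σ : ℕ → Fml) : Fml → Fml
  | var n => σ n
  | bot => bot
  | and A B => and (subst σ A) (subst σ B)
  | or A B => or (subst σ A) (subst σ B)
  | imp A B => imp (subst σ A) (subst σ B)

/-- The set of variables occurring in a formula. -/
def vars : Fml → Finset ℕ
  | var n => {n}
  | bot => ∅
  | and A B => A.vars ∪ B.vars
  | or A B => A.vars ∪ B.vars
  | imp A B => A.vars ∪ B.vars

/-- An injective encoding of formulas into ℕ. -/
def encode : Fml → ℕ
  | var n => 5 * n
  | bot => 1
  | and A B => 5 * Nat.pair A.encode B.encode + 2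
  | or A B => 5 * Nat.pair A.encode B.encode + 3
  | imp A B => 5 * Nat.pair A.encode B.encode + 4

end Fml

open Fml

/-- The standard axioms of the intuitionistic propositional calculus Int. -/
def IntAx : Set Fml :=
  { p.imp (q.imp p),
    (p.imp (q.imp r)).imp ((p.imp q).imp (p.imp r)),
    (p.and q).imp p,
    (p.and q).imp q,
    p.imp (q.imp (p.and q)),
    p.imp (p.or q),
    q.imp (p.or q),
    (p.imp r).imp ((q.imp r).imp ((p.or q).imp r)),
    (p.imp q).imp ((p.imp q.neg).imp p.neg),
    p.imp (p.neg.imp q) }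

/-- Derivability in Int extended with the extra axioms Γ, with rules
    modus ponens and substitution.  `Deriv ∅ A` is `Int ⊢ A`;
    `Deriv {B} A` is `Int + B ⊢ A`. -/
inductive Deriv (Γ : Set Fml) : Fml → Prop
  | ax {A : Fml} : A ∈ IntAx → Deriv Γ A
  | extra {A : Fml} : A ∈ Γ → Deriv Γ A
  | mp {A B : Fml} : Deriv Γ (A.imp B) → Deriv Γ A → Deriv Γ B
  | subst {A : Fml} (σ : ℕ → Fml) : Deriv Γ A → Deriv Γ (A.subst σ)

/-- (S,T) pair: `ST x n = (S_{n-2}[x], T_{n-2}[x])` (index shifted by 2). -/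
def ST (x : Fml) : ℕ → Fml × Fml
  | 0 => (x.neg, x.neg.neg)
  | 1 =>
      let s := Fml.imp x.neg.neg x
      (s, s.imp (Fml.or x.neg x.neg.neg))
  | (n+2) =>
      let st1 := ST x (n+1)
      let st0 := ST x n
      let s := st1.2.imp (st1.1.or st0.2)
      (s, s.imp (st1.1.or st1.2))

def Sf (x : Fml) (n : ℕ) : Fml := (ST x n).1
def Tf (x : Fml) (n : ℕ) : Fml := (ST x n).2

/-- `A0 n = A_{n-5}^0 = S_{n-2}[r]`, `B0 n = B_{n-5}^0` (index shifted by 5). -/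
def A0 (n : ℕ) : Fml := Sf r n
def B0 (n : ℕ) : Fml := Tf r n

def C1 : Fml := A0 5
def C2 : Fml := B0 5

/-- Generic groups (A^1),(B^1) / (A^2),(B^2): `AB v c1 c2 n = (A_{n-5}, B_{n-5})`
    built over the variable `v` (index shifted by 5). -/
def AB (v c1 c2 : Fml) : ℕ → Fml × Fml
  | 0 => (Sf v 0, Tf v 0)
  | 1 => (Sf v 1, Tf v 1)
  | 2 => (Sf v 2, Tf v 2)
  | 3 =>
      let x2 := AB v c1 c2 2
      let x1 := AB v c1 c2 1
      (x2.2.imp (x2.1.or x1.2), x2.1.imp (c1.or x2.2))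
  | 4 =>
      let x3 := AB v c1 c2 3
      let x2 := AB v c1 c2 2
      (x3.2.imp (x3.1.or x2.2), x3.1.imp (x2.1.or x3.2))
  | (n+5) =>
      let x1 := AB v c1 c2 (n+4)
      let x0 := AB v c1 c2 (n+3)
      ((c2.and x1.2).imp (c1.or (x1.1.or x0.2)),
       (c2.and x1.1).imp (c1.or (x0.1.or x1.2)))

/-- `A1 n = A_{n-5}^1` etc. (index shifted by 5). -/
def A1 (n : ℕ) : Fml := (AB p C1 C2 n).1
def B1 (n : ℕ) : Fml := (AB p C1 C2 n).2
def A2 (n : ℕ) : Fml := (AB q C2 C1 n).1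
def B2 (n : ℕ) : Fml := (AB q C2 C1 n).2

/-- `AF j` is the family A^j, `BF j` the family B^j (ℕ-index shifted by 5). -/
def AF : Fin 3 → ℕ → Fml := ![A0, A1, A2]
def BF : Fin 3 → ℕ → Fml := ![B0, B1, B2]

/-- The code E_{s,m,n} of a configuration (s,m,n). -/
def Efml (s m n : ℕ) : Fml :=
  ((A0 (3*s+7)).and ((B0 (3*s+7)).and ((A1 (m+6)).and ((B1 (m+6)).and
      ((A2 (n+6)).and (B2 (n+6))))))).imp
  ((A0 (3*s+6)).or ((B0 (3*s+6)).or ((A1 (m+5)).or ((B1 (m+5)).or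
      ((A2 (n+5)).or (B2 (n+5)))))))

/-- `FG x y k = (F_k[p,q,x,y], G_k[p,q,x,y])`. -/
def FG (x y : Fml) : ℕ → Fml × Fml
  | 0 => (p, q)
  | 1 => ((y.and q).imp (x.or p), (y.and p).imp (x.or q))
  | (k+2) =>
      let fg1 := FG x y (k+1)
      let fg0 := FG x y k
      ((y.and fg1.2).imp (x.or (fg1.1.or fg0.2)),
       (y.and fg1.1).imp (x.or (fg1.2.or fg0.1)))

/-- Key formulas F_k^1, G_k^1, F_k^2, G_k^2 (as formulas in p,q,r). -/
def F1k (k : ℕ) : Fml := (FG C1 C2 k).1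
def G1k (k : ℕ) : Fml := (FG C1 C2 k).2
def F2k (k : ℕ) : Fml := (FG C2 C1 k).1
def G2k (k : ℕ) : Fml := (FG C2 C1 k).2

/-- Substituting X for p and Y for q. -/
def sub2 (X Y : Fml) (A : Fml) : Fml :=
  A.subst (fun n => if n = 0 then X else if n = 1 then Y else var n)

/-- `Pf a b = P_{a-1,b-1}` (indices shifted by 1, so defined for all a,b:ℕ, i.e. i,j ≥ -1). -/
def Pf (a b : ℕ) : Fml :=
  (C2.imp (C1.or ((A1 (a+4)).or (B1 (a+3))))).and
  (C1.imp (C2.or ((A2 (b+4)).or (B2 (b+3)))))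

/-- `Qf a b = Q_{a-1,b-1}` (indices shifted by 1). -/
def Qf (a b : ℕ) : Fml :=
  (C2.imp (C1.or ((A1 (a+3)).or (B1 (a+4))))).and
  (C1.imp (C2.or ((A2 (b+3)).or (B2 (b+4)))))

/-- Ê_{s,i,j} (intended for i,j ≥ 1). -/
def Ehat (s i j : ℕ) : Fml :=
  ((A0 (3*s+7)).and ((B0 (3*s+7)).and ((F1k (i+1)).and ((G1k (i+1)).and
      ((F2k (j+1)).and (G2k (j+1))))))).imp
  ((A0 (3*s+6)).or ((B0 (3*s+6)).or ((F1k i).or ((G1k i).or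
      ((F2k j).or (G2k j))))))

/-- Ê_{s,0,*}. -/
def Ehat0star (s : ℕ) : Fml :=
  ((A0 (3*s+7)).and ((B0 (3*s+7)).and ((A1 6).and (B1 6)))).imp
  ((A0 (3*s+6)).or ((B0 (3*s+6)).or ((A1 5).or ((B1 5).or q))))

/-- Ê_{s,*,0}. -/
def Ehatstar0 (s : ℕ) : Fml :=
  ((A0 (3*s+7)).and ((B0 (3*s+7)).and ((A2 6).and (B2 6)))).imp
  ((A0 (3*s+6)).or ((B0 (3*s+6)).or (p.or ((A2 5).or (B2 5)))))

/-! ### Minsky machines -/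

/-- Configurations (s, m, n). -/
abbrev Cfg := ℕ × ℕ × ℕ

/-- The four forms of Minsky machine instructions. -/
inductive MInstr : Type
  | inc1 (s t : ℕ)                -- s ↦ (t,1,0)
  | inc2 (s t : ℕ)                -- s ↦ (t,0,1)
  | dec1 (s t u : ℕ)              -- s ↦ (t,-1,0)/(u,0,0)
  | dec2 (s t u : ℕ)              -- s ↦ (t,0,-1)/(u,0,0)
deriving DecidableEq

def MInstr.state : MInstr → ℕ
  | inc1 s _ => s
  | inc2 s _ => s
  | dec1 s _ _ => s
  | dec2 s _ _ => s

/-- One application of an instruction to a configuration. -/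
def MInstr.step : MInstr → Cfg → Cfg → Prop
  | inc1 s t, c, c' => ∃ m n, c = (s, m, n) ∧ c' = (t, m + 1, n)
  | inc2 s t, c, c' => ∃ m n, c = (s, m, n) ∧ c' = (t, m, n + 1)
  | dec1 s t u, c, c' => ∃ m n, c = (s, m, n) ∧
      ((0 < m ∧ c' = (t, m - 1, n)) ∨ (m = 0 ∧ c' = (u, 0, n)))
  | dec2 s t u, c, c' => ∃ m n, c = (s, m, n) ∧
      ((0 < n ∧ c' = (t, m, n - 1)) ∨ (n = 0 ∧ c' = (u, m, 0)))

/-- A Minsky machine: a finite deterministic set of instructions. -/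
structure Minsky where
  instrs : List MInstr
  det : ∀ I ∈ instrs, ∀ J ∈ instrs, I.state = J.state → I = J

/-- One step of the machine. -/
def Minsky.Step (M : Minsky) (c c' : Cfg) : Prop := ∃ I ∈ M.instrs, I.step c c'

/-- (s,m,n) ⟹_𝓜 (t,k,l): reachability in finitely many (possibly zero) steps. -/
def Minsky.Reach (M : Minsky) : Cfg → Cfg → Prop := Relation.ReflTransGen M.Step

/-- The formula Ax(I) simulating an instruction I. -/
def AxI : MInstr → Fml
  | .inc1 s t => (Ehat t 2 1).imp (Ehat s 1 1)
  | .inc2 s t => (Ehat t 1 2).imp (Ehat s 1 1)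
  | .dec1 s t u => ((Ehat t 1 1).imp (Ehat s 2 1)).and ((Ehat0star u).imp (Ehat0star s))
  | .dec2 s t u => ((Ehat t 1 1).imp (Ehat s 1 2)).and ((Ehatstar0 u).imp (Ehatstar0 s))

/-- The formula Ax(𝓜): the conjunction of Ax(I) over all instructions of 𝓜. -/
def AxM (M : Minsky) : Fml := M.instrs.foldr (fun I acc => (AxI I).and acc) Fml.bot.neg

/-! ### Kripke semantics and the frame 𝔉 -/

/-- Intuitionistic forcing over an arbitrary accessibility relation R and valuation V. -/
def Force {α : Type} (R : α → α → Prop) (V : ℕ → α → Prop) : α → Fml → Prop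
  | w, Fml.var n => V n w
  | _, Fml.bot => False
  | w, Fml.and A B => Force R V w A ∧ Force R V w B
  | w, Fml.or A B => Force R V w A ∨ Force R V w B
  | w, Fml.imp A B => ∀ w', R w w' → Force R V w' A → Force R V w' B

/-- A valuation is R-upward-closed. -/
def UpClosed {α : Type} (R : α → α → Prop) (V : ℕ → α → Prop) : Prop :=
  ∀ n w w', V n w → R w w' → V n w'

/-- The equivalence ∼_𝓜: mutual reachability. -/
def MEquiv (M : Minsky) : Setoid Cfg where
  r c c' := M.Reach c c' ∧ M.Reach c' c
  iseqv := ⟨fun _ => ⟨Relation.ReflTransGen.refl, Relation.ReflTransGen.refl⟩,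
    fun h => ⟨h.2, h.1⟩, fun h h' => ⟨h.1.trans h'.1, h'.2.trans h.2⟩⟩

/-- Equivalence classes of configurations. -/
def Cl (M : Minsky) := Quotient (MEquiv M)

/-- The class [c] of a configuration c. -/
def cl (M : Minsky) (c : Cfg) : Cl M := Quotient.mk (MEquiv M) c

/-- ⟹_𝓜 lifted to equivalence classes. -/
def ClReach (M : Minsky) (α β : Cl M) : Prop :=
  ∃ c c', cl M c = α ∧ cl M c' = β ∧ M.Reach c c'

/-- Raw points: a_i^j, b_i^j (ℕ-index n = i+5, so i ≥ -5) and e_α. -/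
inductive Pt (M : Minsky) : Type
  | a (j : Fin 3) (n : ℕ)
  | b (j : Fin 3) (n : ℕ)
  | e (α : Cl M)

/-- The immediate-accessibility relation R' of the frame 𝔉 (on raw points). -/
inductive Edge (M : Minsky) (c0 : Cfg) : Pt M → Pt M → Prop
  | a4a5 (j : Fin 3) : Edge M c0 (.a j 1) (.a j 0)
  | b4a5 (j : Fin 3) : Edge M c0 (.b j 1) (.a j 0)
  | b4b5 (j : Fin 3) : Edge M c0 (.b j 1) (.b j 0)
  | a3a4 (j : Fin 3) : Edge M c0 (.a j 2) (.a j 1)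
  | a3b5 (j : Fin 3) : Edge M c0 (.a j 2) (.b j 0)
  | b3a4 (j : Fin 3) : Edge M c0 (.b j 2) (.a j 1)
  | b3b4 (j : Fin 3) : Edge M c0 (.b j 2) (.b j 1)
  -- group j = 0, i ≥ -2:
  | a0a (n : ℕ) : Edge M c0 (.a 0 (n+3)) (.a 0 (n+2))
  | a0b (n : ℕ) : Edge M c0 (.a 0 (n+3)) (.b 0 (n+1))
  | b0a (n : ℕ) : Edge M c0 (.b 0 (n+3)) (.a 0 (n+2))
  | b0b (n : ℕ) : Edge M c0 (.b 0 (n+3)) (.b 0 (n+2))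
  -- groups j = 1,2 at i = -2:
  | am2a (j : Fin 3) (h : j ≠ 0) : Edge M c0 (.a j 3) (.a j 2)
  | am2b (j : Fin 3) (h : j ≠ 0) : Edge M c0 (.a j 3) (.b j 1)
  | bm2each1 : Edge M c0 (.b 1 3) (.a 0 5)
  | bm2b1 : Edge M c0 (.b 1 3) (.b 1 2)
  | bm2each2 : Edge M c0 (.b 2 3) (.b 0 5)
  | bm2b2 : Edge M c0 (.b 2 3) (.b 2 2)
  -- groups j = 1,2, i ≥ -1:
  | aja (j : Fin 3) (h : j ≠ 0) (n : ℕ) : Edge M c0 (.a j (n+4)) (.a j (n+3))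
  | ajb (j : Fin 3) (h : j ≠ 0) (n : ℕ) : Edge M c0 (.a j (n+4)) (.b j (n+2))
  | bja (j : Fin 3) (h : j ≠ 0) (n : ℕ) : Edge M c0 (.b j (n+4)) (.a j (n+2))
  | bjb (j : Fin 3) (h : j ≠ 0) (n : ℕ) : Edge M c0 (.b j (n+4)) (.b j (n+3))
  -- group R_{s,m,n}:
  | e1 (s m n : ℕ) (h : M.Reach c0 (s,m,n)) : Edge M c0 (.e (cl M (s,m,n))) (.a 0 (3*s+6))
  | e2 (s m n : ℕ) (h : M.Reach c0 (s,m,n)) : Edge M c0 (.e (cl M (s,m,n))) (.b 0 (3*s+6))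
  | e3 (s m n : ℕ) (h : M.Reach c0 (s,m,n)) : Edge M c0 (.e (cl M (s,m,n))) (.a 1 (m+5))
  | e4 (s m n : ℕ) (h : M.Reach c0 (s,m,n)) : Edge M c0 (.e (cl M (s,m,n))) (.b 1 (m+5))
  | e5 (s m n : ℕ) (h : M.Reach c0 (s,m,n)) : Edge M c0 (.e (cl M (s,m,n))) (.a 2 (n+5))
  | e6 (s m n : ℕ) (h : M.Reach c0 (s,m,n)) : Edge M c0 (.e (cl M (s,m,n))) (.b 2 (n+5))
  -- (e_α, e_β) whenever α ⟹ β: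
  | ee (c c' : Cfg) (h : M.Reach c c') : Edge M c0 (.e (cl M c)) (.e (cl M c'))

/-- Which raw points belong to the set of worlds W. -/
def Valid (M : Minsky) (c0 : Cfg) : Pt M → Prop
  | .e α => ClReach M (cl M c0) α
  | _ => True

/-- The set of worlds W of the frame 𝔉. -/
def W (M : Minsky) (c0 : Cfg) := {x : Pt M // Valid M c0 x}

/-- The accessibility relation R of 𝔉: reflexive-transitive closure of R'. -/
def Rel (M : Minsky) (c0 : Cfg) : W M c0 → W M c0 → Prop :=
  Relation.ReflTransGen (fun x y => Edge M c0 x.1 y.1)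

/-- The point a_{n-5}^j of W. -/
def aPt (M : Minsky) (c0 : Cfg) (j : Fin 3) (n : ℕ) : W M c0 := ⟨.a j n, trivial⟩

/-- The point b_{n-5}^j of W. -/
def bPt (M : Minsky) (c0 : Cfg) (j : Fin 3) (n : ℕ) : W M c0 := ⟨.b j n, trivial⟩

/-- The point e_{[c]} of W (for a reachable configuration c). -/
def ePt (M : Minsky) (c0 : Cfg) (c : Cfg) (h : M.Reach c0 c) : W M c0 :=
  ⟨.e (cl M c), ⟨c0, c, rfl, rfl, h⟩⟩

/-- The valuation 𝔙 of the model 𝔐 (p = var 0 ↔ group 1, q = var 1 ↔ group 2,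
    r = var 2 ↔ group 0). -/
def V0 (M : Minsky) (c0 : Cfg) : ℕ → W M c0 → Prop
  | 0, w => ¬ (Rel M c0 w (aPt M c0 1 1) ∨ Rel M c0 w (bPt M c0 1 0))
  | 1, w => ¬ (Rel M c0 w (aPt M c0 2 1) ∨ Rel M c0 w (bPt M c0 2 0))
  | 2, w => ¬ (Rel M c0 w (aPt M c0 0 1) ∨ Rel M c0 w (bPt M c0 0 0))
  | _, _ => True

end Paper

namespace Paper

open Fml

/-! ### Basic derivations in Int -/

namespace Deriv

variable {Γ : Set Fml} {A B C : Fml}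

/-- The substitution sending the variables `p, q, r` to `A, B, C`. -/
def assign (A B C : Fml) : ℕ → Fml
  | 0 => A
  | 1 => B
  | _ => C

theorem imp_const (A B : Fml) : Deriv Γ (A.imp (B.imp A)) :=
  subst (assign A B B) (ax (A := p.imp (q.imp p)) (by simp [IntAx]))

theorem imp_distrib (A B C : Fml) :
    Deriv Γ ((A.imp (B.imp C)).imp ((A.imp B).imp (A.imp C))) :=
  subst (assign A B C)
    (ax (A := (p.imp (q.imp r)).imp ((p.imp q).imp (p.imp r))) (by simp [IntAx]))

theorem and_left (A B : Fml) : Deriv Γ ((A.and B).imp A) :=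
  subst (assign A B B) (ax (A := (p.and q).imp p) (by simp [IntAx]))

theorem and_right (A B : Fml) : Deriv Γ ((A.and B).imp B) :=
  subst (assign A B B) (ax (A := (p.and q).imp q) (by simp [IntAx]))

theorem and_intro (A B : Fml) : Deriv Γ (A.imp (B.imp (A.and B))) :=
  subst (assign A B B) (ax (A := p.imp (q.imp (p.and q))) (by simp [IntAx]))

theorem or_inl (A B : Fml) : Deriv Γ (A.imp (A.or B)) :=
  subst (assign A B B) (ax (A := p.imp (p.or q)) (by simp [IntAx]))

theorem or_inr (A B : Fml) : Deriv Γ (B.imp (A.or B)) :=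
  subst (assign A B B) (ax (A := q.imp (p.or q)) (by simp [IntAx]))

theorem or_elim (A B C : Fml) :
    Deriv Γ ((A.imp C).imp ((B.imp C).imp ((A.or B).imp C))) :=
  subst (assign A B C)
    (ax (A := (p.imp r).imp ((q.imp r).imp ((p.or q).imp r))) (by simp [IntAx]))

theorem absurd (A B : Fml) : Deriv Γ (A.imp (A.neg.imp B)) :=
  subst (assign A B B) (ax (A := p.imp (p.neg.imp q)) (by simp [IntAx]))

theorem weaken (h : Deriv Γ B) : Deriv Γ (A.imp B) := (imp_const B A).mp h

theorem mp_under (h : Deriv Γ (A.imp (B.imp C))) (h' : Deriv Γ (A.imp B)) :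
    Deriv Γ (A.imp C) := ((imp_distrib A B C).mp h).mp h'

theorem imp_refl (A : Fml) : Deriv Γ (A.imp A) :=
  mp_under (imp_const A (A.imp A)) (imp_const A A)

theorem imp_trans (h : Deriv Γ (A.imp B)) (h' : Deriv Γ (B.imp C)) : Deriv Γ (A.imp C) :=
  mp_under (weaken h') h

theorem imp_and (h : Deriv Γ (A.imp B)) (h' : Deriv Γ (A.imp C)) :
    Deriv Γ (A.imp (B.and C)) :=
  mp_under (imp_trans h (and_intro B C)) h'

theorem or_imp (h : Deriv Γ (A.imp C)) (h' : Deriv Γ (B.imp C)) :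
    Deriv Γ ((A.or B).imp C) :=
  ((or_elim A B C).mp h).mp h'

theorem bot_imp (A : Fml) : Deriv Γ (bot.imp A) :=
  mp_under (absurd bot A) (weaken (imp_refl bot))

theorem uncurry (h : Deriv Γ (A.imp (B.imp C))) : Deriv Γ ((A.and B).imp C) :=
  mp_under (imp_trans (and_left A B) h) (and_right A B)

theorem curry (h : Deriv Γ ((A.and B).imp C)) : Deriv Γ (A.imp (B.imp C)) :=
  imp_trans (and_intro A B) ((imp_distrib B (A.and B) C).mp (weaken h))

theorem imp_mono {A' B' : Fml} (hA : Deriv Γ (A'.imp A)) (hB : Deriv Γ (B.imp B')) :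
    Deriv Γ ((A.imp B).imp (A'.imp B')) :=
  curry (imp_trans (mp_under (and_left _ _) (imp_trans (and_right _ _) hA)) hB)

end Deriv

/-! ### The Lindenbaum algebra and completeness for Heyting algebras -/

/-- Formulas preordered by provable implication in Int. -/
instance : Preorder Fml where
  le A B := Deriv ∅ (A.imp B)
  le_refl := Deriv.imp_refl
  le_trans _ _ _ := Deriv.imp_trans

/-- The Lindenbaum algebra of Int. -/
abbrev Lindenbaum : Type := Antisymmetrization Fml (· ≤ ·)

namespace Lindenbaum

/-- The class of a formula modulo provable equivalence. -/
def mk (A : Fml) : Lindenbaum := toAntisymmetrization (· ≤ ·) A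

instance : HeytingAlgebra Lindenbaum where
  sup := Quotient.map₂ Fml.or fun A A' hA B B' hB =>
    ⟨Deriv.or_imp (Deriv.imp_trans hA.1 (Deriv.or_inl A' B'))
        (Deriv.imp_trans hB.1 (Deriv.or_inr A' B')),
      Deriv.or_imp (Deriv.imp_trans hA.2 (Deriv.or_inl A B))
        (Deriv.imp_trans hB.2 (Deriv.or_inr A B))⟩
  inf := Quotient.map₂ Fml.and fun A A' hA B B' hB =>
    ⟨Deriv.imp_and (Deriv.imp_trans (Deriv.and_left A B) hA.1)
        (Deriv.imp_trans (Deriv.and_right A B) hB.1),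
      Deriv.imp_and (Deriv.imp_trans (Deriv.and_left A' B') hA.2)
        (Deriv.imp_trans (Deriv.and_right A' B') hB.2)⟩
  himp := Quotient.map₂ Fml.imp fun _ _ hA _ _ hB =>
    ⟨Deriv.imp_mono hA.2 hB.1, Deriv.imp_mono hA.1 hB.2⟩
  compl := Quotient.map Fml.neg fun _ _ hA =>
    ⟨Deriv.imp_mono hA.2 (Deriv.imp_refl bot), Deriv.imp_mono hA.1 (Deriv.imp_refl bot)⟩
  top := mk (bot.imp bot)
  bot := mk bot
  le_sup_left := by rintro ⟨A⟩ ⟨B⟩; exact Deriv.or_inl A B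
  le_sup_right := by rintro ⟨A⟩ ⟨B⟩; exact Deriv.or_inr A B
  sup_le := by rintro ⟨A⟩ ⟨B⟩ ⟨C⟩ hA hB; exact Deriv.or_imp hA hB
  inf_le_left := by rintro ⟨A⟩ ⟨B⟩; exact Deriv.and_left A B
  inf_le_right := by rintro ⟨A⟩ ⟨B⟩; exact Deriv.and_right A B
  le_inf := by rintro ⟨A⟩ ⟨B⟩ ⟨C⟩ hB hC; exact Deriv.imp_and hB hC
  le_top := by rintro ⟨A⟩; exact Deriv.weaken (Deriv.imp_refl bot)
  bot_le := by rintro ⟨A⟩; exact Deriv.bot_imp A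
  le_himp_iff := by rintro ⟨A⟩ ⟨B⟩ ⟨C⟩; exact ⟨Deriv.uncurry, Deriv.curry⟩
  himp_bot := by rintro ⟨A⟩; rfl

end Lindenbaum

/-- The value of a formula in a Heyting algebra under a valuation of the variables. -/
def eval {H : Type*} [HeytingAlgebra H] (v : ℕ → H) : Fml → H
  | .var n => v n
  | .bot => ⊥
  | .and A B => eval v A ⊓ eval v B
  | .or A B => eval v A ⊔ eval v B
  | .imp A B => eval v A ⇨ eval v B

theorem eval_lindenbaum (A : Fml) :
    eval (fun n => Lindenbaum.mk (var n)) A = Lindenbaum.mk A := by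
  induction A with
  | var n => rfl
  | bot => rfl
  | and A B hA hB => rw [eval, hA, hB]; rfl
  | or A B hA hB => rw [eval, hA, hB]; rfl
  | imp A B hA hB => rw [eval, hA, hB]; rfl

/-- Formulas with equal values in all Heyting algebras are provably equivalent in Int. -/
theorem deriv_biimp_of_eval_eq {A B : Fml}
    (h : ∀ (H : Type) [HeytingAlgebra H] (v : ℕ → H), eval v A = eval v B) :
    Deriv ∅ (A.biimp B) := by
  have hAB := h Lindenbaum fun n => Lindenbaum.mk (var n)
  rw [eval_lindenbaum, eval_lindenbaum, le_antisymm_iff] at hAB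
  exact ((Deriv.and_intro _ _).mp hAB.1).mp hAB.2

/-! ### Evaluation and substitution -/

section Eval

variable {H : Type*} [HeytingAlgebra H]

theorem eval_subst (v : ℕ → H) (σ : ℕ → Fml) (A : Fml) :
    eval v (A.subst σ) = eval (fun n => eval v (σ n)) A := by
  induction A with
  | var n => rfl
  | bot => rfl
  | and A B hA hB => rw [Fml.subst, eval, eval, hA, hB]
  | or A B hA hB => rw [Fml.subst, eval, eval, hA, hB]
  | imp A B hA hB => rw [Fml.subst, eval, eval, hA, hB]

/-- The valuation `v` with the values of `p` and `q` replaced by `a` and `b`. -/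
def updatePQ (v : ℕ → H) (a b : H) : ℕ → H
  | 0 => a
  | 1 => b
  | n + 2 => v (n + 2)

theorem eval_sub2 (v : ℕ → H) (X Y A : Fml) :
    eval v (sub2 X Y A) = eval (updatePQ v (eval v X) (eval v Y)) A := by
  rw [sub2, eval_subst]
  congr 1
  funext n
  match n with
  | 0 => rfl
  | 1 => rfl
  | n + 2 => rfl

variable {v w : ℕ → H}

theorem eval_ST_congr {x : Fml} (hx : eval v x = eval w x) (n : ℕ) :
    eval v (ST x n).1 = eval w (ST x n).1 ∧ eval v (ST x n).2 = eval w (ST x n).2 := by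
  induction n using Nat.twoStepInduction with
  | zero => simp [ST, neg, eval, hx]
  | one => simp [ST, neg, eval, hx]
  | more n h0 h1 => simp [ST, eval, h0, h1]

theorem eval_A0_congr (h : v 2 = w 2) (n : ℕ) : eval v (A0 n) = eval w (A0 n) :=
  (eval_ST_congr (x := r) h n).1

theorem eval_B0_congr (h : v 2 = w 2) (n : ℕ) : eval v (B0 n) = eval w (B0 n) :=
  (eval_ST_congr (x := r) h n).2

theorem eval_AB_congr {x c d : Fml} (hx : eval v x = eval w x) (hc : eval v c = eval w c)
    (hd : eval v d = eval w d) (n : ℕ) :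
    eval v (AB x c d n).1 = eval w (AB x c d n).1 ∧
      eval v (AB x c d n).2 = eval w (AB x c d n).2 := by
  induction n using Nat.strong_induction_on with
  | _ n ih =>
    match n with
    | 0 => exact eval_ST_congr hx 0
    | 1 => exact eval_ST_congr hx 1
    | 2 => exact eval_ST_congr hx 2
    | 3 =>
      obtain ⟨h1, h1'⟩ := ih 1 (by omega)
      obtain ⟨h2, h2'⟩ := ih 2 (by omega)
      rw [AB]
      simp only [eval, h1', h2, h2', hc, and_self]
    | 4 =>
      obtain ⟨h2, h2'⟩ := ih 2 (by omega)
      obtain ⟨h3, h3'⟩ := ih 3 (by omega)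
      rw [AB]
      simp only [eval, h2, h2', h3, h3', and_self]
    | n + 5 => simp [AB, eval, ih (n + 4), ih (n + 3), hc, hd]

theorem eval_A1_congr (h0 : v 0 = w 0) (h2 : v 2 = w 2) (n : ℕ) :
    eval v (A1 n) = eval w (A1 n) :=
  (eval_AB_congr (x := p) h0 (eval_A0_congr h2 5) (eval_B0_congr h2 5) n).1

theorem eval_B1_congr (h0 : v 0 = w 0) (h2 : v 2 = w 2) (n : ℕ) :
    eval v (B1 n) = eval w (B1 n) :=
  (eval_AB_congr (x := p) h0 (eval_A0_congr h2 5) (eval_B0_congr h2 5) n).2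

theorem eval_A2_congr (h1 : v 1 = w 1) (h2 : v 2 = w 2) (n : ℕ) :
    eval v (A2 n) = eval w (A2 n) :=
  (eval_AB_congr (x := q) h1 (eval_B0_congr h2 5) (eval_A0_congr h2 5) n).1

theorem eval_B2_congr (h1 : v 1 = w 1) (h2 : v 2 = w 2) (n : ℕ) :
    eval v (B2 n) = eval w (B2 n) :=
  (eval_AB_congr (x := q) h1 (eval_B0_congr h2 5) (eval_A0_congr h2 5) n).2

/-! ### The key formulas under the substitution of `P` and `Q` -/

theorem himp_congr_of_inf_eq {d x y y' : H} (h : d ⊓ y = d ⊓ y') : d ⊓ x ⇨ y = d ⊓ x ⇨ y' := by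
  have key (z : H) : d ⊓ x ⇨ z = d ⊓ x ⇨ d ⊓ z := by
    rw [himp_inf_distrib, himp_eq_top_iff.2 (inf_le_left : d ⊓ x ≤ d), top_inf_eq]
  rw [key y, key y', h]

theorem himp_eq_of_inf_eq_sup {c d e x y z : H} (h : d ⊓ x = d ⊓ (c ⊔ (e ⊔ y))) (hc : c ≤ z)
    (he : e ≤ z) : d ⊓ x ⇨ z = d ⊓ y ⇨ z := by
  rw [h, inf_sup_left, inf_sup_left, sup_himp_distrib, sup_himp_distrib,
    himp_eq_top_iff.2 (inf_le_right.trans hc), himp_eq_top_iff.2 (inf_le_right.trans he),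
    top_inf_eq, top_inf_eq]

theorem inf_sup_eq_of_inf_eq_sup {c d e x y z : H} (h : d ⊓ y = d ⊓ (c ⊔ (e ⊔ z)))
    (he : e ≤ x) : d ⊓ (c ⊔ (x ⊔ y)) = d ⊓ (c ⊔ (x ⊔ z)) := by
  simp only [inf_sup_left] at h ⊢
  have hdx : d ⊓ e ≤ d ⊓ x := inf_le_inf_left d he
  rw [h]
  apply le_antisymm
  · exact sup_le le_sup_left (sup_le (le_sup_left.trans le_sup_right)
      (sup_le le_sup_left (sup_le_sup_right hdx _ |>.trans le_sup_right)))
  · exact sup_le_sup_left (sup_le_sup_left (le_sup_right.trans le_sup_right) _) _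

theorem inf_guarded_left {c d x y : H} :
    d ⊓ ((d ⇨ c ⊔ x) ⊓ (c ⇨ d ⊔ y)) = d ⊓ (c ⊔ x) := by
  have h : d ≤ c ⇨ d ⊔ y := le_sup_left.trans le_himp
  rw [← inf_assoc, inf_himp, inf_eq_left]
  exact inf_le_left.trans h

theorem inf_guarded_right {c d x y : H} :
    c ⊓ ((d ⇨ c ⊔ x) ⊓ (c ⇨ d ⊔ y)) = c ⊓ (d ⊔ y) := by
  rw [inf_comm (d ⇨ c ⊔ x)]
  exact inf_guarded_left

/-- If `a`, `b` satisfy the recursion defining `AB`, and the values of `p` and `q` agree with those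
of the formulas `P` and `Q` below the value of `y`, then the key formulas `FG x y` take the values
`a` and `b`. -/
theorem eval_FG_of_recursion {x y : Fml} {a b : ℕ → H}
    (ha : ∀ k, a (k + 2) = eval v y ⊓ b (k + 1) ⇨ eval v x ⊔ (a (k + 1) ⊔ b k))
    (hb : ∀ k, b (k + 2) = eval v y ⊓ a (k + 1) ⇨ eval v x ⊔ (a k ⊔ b (k + 1)))
    (ha0 : a 0 ≤ a 1) (hb0 : b 0 ≤ b 1)
    (hp : eval v y ⊓ v 0 = eval v y ⊓ (eval v x ⊔ (a 1 ⊔ b 0)))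
    (hq : eval v y ⊓ v 1 = eval v y ⊓ (eval v x ⊔ (a 0 ⊔ b 1))) (k : ℕ) :
    eval v (FG x y (k + 1)).1 = a (k + 2) ∧ eval v (FG x y (k + 1)).2 = b (k + 2) := by
  have hF0 : eval v (FG x y 0).1 = v 0 := rfl
  have hG0 : eval v (FG x y 0).2 = v 1 := rfl
  have hp' : eval v y ⊓ v 0 = eval v y ⊓ (eval v x ⊔ (b 0 ⊔ a 1)) := by rw [hp, sup_comm (a 1)]
  have hF1 : eval v (FG x y 1).1 = a 2 := by
    have h : eval v y ⊓ (eval v x ⊔ v 0) = eval v y ⊓ (eval v x ⊔ (a 1 ⊔ b 0)) := by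
      rw [inf_sup_left, hp, ← inf_sup_left, ← sup_assoc, sup_idem]
    simp only [FG, eval]
    rw [ha 0, ← himp_eq_of_inf_eq_sup hq le_sup_left
      (ha0.trans (le_sup_left.trans le_sup_right)), ← himp_congr_of_inf_eq h]
    rfl
  have hG1 : eval v (FG x y 1).2 = b 2 := by
    have h : eval v y ⊓ (eval v x ⊔ v 1) = eval v y ⊓ (eval v x ⊔ (a 0 ⊔ b 1)) := by
      rw [inf_sup_left, hq, ← inf_sup_left, ← sup_assoc, sup_idem]
    simp only [FG, eval]
    rw [hb 0, ← himp_eq_of_inf_eq_sup hp' le_sup_left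
      (hb0.trans (le_sup_right.trans le_sup_right)), ← himp_congr_of_inf_eq h]
    rfl
  induction k using Nat.twoStepInduction with
  | zero => exact ⟨hF1, hG1⟩
  | one =>
    have hab : a 0 ≤ a 2 := by
      rw [ha 0]; exact (ha0.trans (le_sup_left.trans le_sup_right)).trans le_himp
    have hbb : b 0 ≤ b 2 := by
      rw [hb 0]; exact (hb0.trans (le_sup_right.trans le_sup_right)).trans le_himp
    constructor
    · rw [FG]
      simp only [eval]
      rw [hF1, hG1, hG0, himp_congr_of_inf_eq (inf_sup_eq_of_inf_eq_sup hq hab), ha 1]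
    · rw [FG]
      simp only [eval]
      rw [hF1, hG1, hF0, himp_congr_of_inf_eq (inf_sup_eq_of_inf_eq_sup hp' hbb), hb 1,
        sup_comm (b 2)]
  | more k h0 h1 =>
    constructor
    · rw [FG]
      simp only [eval]
      rw [h1.1, h1.2, h0.2, ha (k + 2)]
    · rw [FG]
      simp only [eval]
      rw [h1.1, h1.2, h0.1, hb (k + 2), sup_comm (b (k + 3))]

theorem eval_AB_add_five (v : ℕ → H) (x c d : Fml) (n : ℕ) :
    eval v (AB x c d (n + 5)).1 = eval v d ⊓ eval v (AB x c d (n + 4)).2 ⇨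
        eval v c ⊔ (eval v (AB x c d (n + 4)).1 ⊔ eval v (AB x c d (n + 3)).2) ∧
      eval v (AB x c d (n + 5)).2 = eval v d ⊓ eval v (AB x c d (n + 4)).1 ⇨
        eval v c ⊔ (eval v (AB x c d (n + 3)).1 ⊔ eval v (AB x c d (n + 4)).2) := by
  rw [AB]; exact ⟨rfl, rfl⟩

theorem eval_AB_le_succ (v : ℕ → H) (x c d : Fml) (n : ℕ) :
    eval v (AB x c d (n + 3)).1 ≤ eval v (AB x c d (n + 4)).1 ∧
      eval v (AB x c d (n + 3)).2 ≤ eval v (AB x c d (n + 4)).2 := by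
  match n with
  | 0 =>
    rw [AB.eq_5]
    exact ⟨le_sup_left.trans le_himp, le_sup_right.trans le_himp⟩
  | n + 1 =>
    rw [(eval_AB_add_five v x c d n).1, (eval_AB_add_five v x c d n).2]
    exact ⟨(le_sup_left.trans le_sup_right).trans le_himp,
      (le_sup_right.trans le_sup_right).trans le_himp⟩

/-- The key formulas `F_{k+1}`, `G_{k+1}` reproduce the formulas of the group built over `z` when
`p` and `q` are evaluated, below `d`, like the relevant conjuncts of `P` and `Q`. -/
theorem eval_FG_eq_eval_AB {z c d : Fml} {a : ℕ} (hc : eval w c = eval v c)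
    (hd : eval w d = eval v d)
    (hp : eval v d ⊓ w 0 = eval v d ⊓
      (eval v c ⊔ (eval v (AB z c d (a + 4)).1 ⊔ eval v (AB z c d (a + 3)).2)))
    (hq : eval v d ⊓ w 1 = eval v d ⊓
      (eval v c ⊔ (eval v (AB z c d (a + 3)).1 ⊔ eval v (AB z c d (a + 4)).2))) (k : ℕ) :
    eval w (FG c d (k + 1)).1 = eval v (AB z c d (a + k + 5)).1 ∧
      eval w (FG c d (k + 1)).2 = eval v (AB z c d (a + k + 5)).2 := by
  have key := eval_FG_of_recursion (v := w) (x := c) (y := d)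
    (a := fun k => eval v (AB z c d (a + k + 3)).1)
    (b := fun k => eval v (AB z c d (a + k + 3)).2)
    (fun k => by rw [hc, hd]; exact (eval_AB_add_five v z c d (a + k)).1)
    (fun k => by rw [hc, hd]; exact (eval_AB_add_five v z c d (a + k)).2)
    (eval_AB_le_succ v z c d a).1 (eval_AB_le_succ v z c d a).2
    (by rw [hc, hd]; exact hp) (by rw [hc, hd]; exact hq) k
  exact key

theorem eval_sub2_Ehat (v : ℕ → H) (s a b i j : ℕ) :
    eval v (sub2 (Pf a b) (Qf a b) (Ehat s (i + 1) (j + 1))) =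
      eval v (Efml s (a + i) (b + j)) := by
  rw [eval_sub2]
  set w := updatePQ v (eval v (Pf a b)) (eval v (Qf a b))
  have h2 : w 2 = v 2 := rfl
  have hC1 : eval w C1 = eval v C1 := eval_A0_congr h2 5
  have hC2 : eval w C2 = eval v C2 := eval_B0_congr h2 5
  have h1 := eval_FG_eq_eval_AB (v := v) (w := w) (z := p) (a := a) hC1 hC2
    inf_guarded_left inf_guarded_left
  have h2' := eval_FG_eq_eval_AB (v := v) (w := w) (z := q) (a := b) hC2 hC1
    inf_guarded_right inf_guarded_right
  simp only [Ehat, Efml, eval, F1k, G1k, F2k, G2k, A1, B1, A2, B2, h1, h2', eval_A0_congr h2,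
    eval_B0_congr h2]
  rfl

theorem eval_sub2_Ehat0star (v : ℕ → H) (s n : ℕ) :
    eval v (((A2 (n + 6)).and (B2 (n + 6))).imp
      (sub2 p ((A2 (n + 5)).or (B2 (n + 5))) (Ehat0star s))) = eval v (Efml s 0 n) := by
  rw [eval, eval_sub2]
  set w := updatePQ v (eval v p) (eval v ((A2 (n + 5)).or (B2 (n + 5))))
  have h0 : w 0 = v 0 := rfl
  have h2 : w 2 = v 2 := rfl
  have h1 : eval w q = eval v (A2 (n + 5)) ⊔ eval v (B2 (n + 5)) := rfl
  simp only [Ehat0star, Efml, eval, h1, eval_A0_congr h2, eval_B0_congr h2, eval_A1_congr h0 h2,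
    eval_B1_congr h0 h2, himp_himp]
  ac_rfl

theorem eval_sub2_Ehatstar0 (v : ℕ → H) (s m : ℕ) :
    eval v (((A1 (m + 6)).and (B1 (m + 6))).imp
      (sub2 ((A1 (m + 5)).or (B1 (m + 5))) q (Ehatstar0 s))) = eval v (Efml s m 0) := by
  rw [eval, eval_sub2]
  set w := updatePQ v (eval v ((A1 (m + 5)).or (B1 (m + 5)))) (eval v q)
  have h1 : w 1 = v 1 := rfl
  have h2 : w 2 = v 2 := rfl
  have h0 : eval w p = eval v (A1 (m + 5)) ⊔ eval v (B1 (m + 5)) := rfl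
  simp only [Ehatstar0, Efml, eval, h0, eval_A0_congr h2, eval_B0_congr h2, eval_A2_congr h1 h2,
    eval_B2_congr h1 h2, himp_himp]
  ac_rfl

end Eval

end Paper

open Paper Paper.Fml in
/-- the four Int-equivalences for E_{s,m,n}
    (P/Q-indices shifted by 1: P_{m-i,n-j} ↦ Pf (m+1-i) (n+1-j); A/B-indices shifted by 5). -/
theorem statement6 (s m n : ℕ) :
    (∀ i j : ℕ, 1 ≤ i → i ≤ m + 1 → 1 ≤ j → j ≤ n + 1 →
      Deriv ∅ ((Efml s m n).biimp
        (sub2 (Pf (m + 1 - i) (n + 1 - j)) (Qf (m + 1 - i) (n + 1 - j)) (Ehat s i j)))) ∧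
    (m = 0 → 1 ≤ n →
      Deriv ∅ ((Efml s 0 n).biimp
        (((A2 (n+6)).and (B2 (n+6))).imp
          (sub2 Fml.p ((A2 (n+5)).or (B2 (n+5))) (Ehat0star s))))) ∧
    (1 ≤ m → n = 0 →
      Deriv ∅ ((Efml s m 0).biimp
        (((A1 (m+6)).and (B1 (m+6))).imp
          (sub2 ((A1 (m+5)).or (B1 (m+5))) Fml.q (Ehatstar0 s))))) ∧
    Deriv ∅ ((Efml s 0 0).biimp (Efml s 0 0)) := by
  refine ⟨fun i j hi him hj hjn => ?_, fun _ _ => ?_, fun _ _ => ?_, ?_⟩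
  · obtain ⟨i, rfl⟩ := Nat.exists_eq_add_of_le' hi
    obtain ⟨j, rfl⟩ := Nat.exists_eq_add_of_le' hj
    refine deriv_biimp_of_eval_eq fun H _ v => ?_
    rw [eval_sub2_Ehat]
    congr 2 <;> omega
  · exact deriv_biimp_of_eval_eq fun H _ v => (eval_sub2_Ehat0star v s n).symm
  · exact deriv_biimp_of_eval_eq fun H _ v => (eval_sub2_Ehatstar0 v s m).symm
  · exact deriv_biimp_of_eval_eq fun H _ v => rfl
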